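/- Let α ∈ (0,1) satisfy T(α) > 0, and let τ₁ ∈ (−1,0) be such that c(α,τ₁) = 0. If τ₀ ∈ (−1,0) satisfies C(α,τ₀) = 0, then τ₀ < τ₁. (In the notation of the paper: τ₀(α) < τ₁(α) for all α ∈ (0,α₀).) -/

import Mathlib

open MeasureTheory Real Set

noncomputable def c (α τ : ℝ) : ℝ :=
  ∫ t in Set.Ioi (0:ℝ), (|1 - t| ^ τ + (1 + t) ^ τ - 2) / t ^ (1 + 2 * α)

noncomputable def bigC (α τ : ℝ) : ℝ :=
  ∫ t in Set.Ioi (0:ℝ),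
    ((Set.Ioo (0:ℝ) 1).indicator (fun s => |1 - s| ^ τ) t + (1 + t) ^ τ - 2) / t ^ (1 + 2 * α)

noncomputable def T (α : ℝ) : ℝ :=
  ∫ t in Set.Ioi (0:ℝ), Real.log |1 - t ^ 2| / t ^ (1 + 2 * α)

lemma rpow_mul_le_affine {x σ θ : ℝ} (hx : 0 ≤ x) (h0 : 0 ≤ θ) (h1 : θ ≤ 1) :
    x ^ (σ * θ) ≤ θ * x ^ σ + (1 - θ) := by
  have h := Real.geom_mean_le_arith_mean2_weighted h0 (sub_nonneg.2 h1)
    (Real.rpow_nonneg hx σ) zero_le_one (by ring)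
  rwa [Real.one_rpow, mul_one, mul_one, ← Real.rpow_mul hx] at h

lemma integrableOn_abs_one_sub_rpow {τ : ℝ} (hτ : -1 < τ) :
    IntegrableOn (fun t : ℝ => |1 - t| ^ τ) (Ioc (1 / 2) 2) := by
  have h := intervalIntegral.intervalIntegrable_rpow' (a := 0) (b := 1) hτ
  have h1 : IntegrableOn (fun t : ℝ => |1 - t| ^ τ) (Ioc 0 1) := by
    have := (h.comp_sub_left 1).symm
    norm_num at this
    rw [intervalIntegrable_iff_integrableOn_Ioc_of_le zero_le_one] at this
    refine this.congr_fun (fun t ht => ?_) measurableSet_Ioc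
    simp only [abs_of_nonneg (sub_nonneg.2 ht.2)]
  have h2 : IntegrableOn (fun t : ℝ => |1 - t| ^ τ) (Ioc 1 2) := by
    have := h.comp_sub_right 1
    norm_num at this
    rw [intervalIntegrable_iff_integrableOn_Ioc_of_le one_le_two] at this
    refine this.congr_fun (fun t ht => ?_) measurableSet_Ioc
    simp only [abs_sub_comm 1 t, abs_of_nonneg (sub_nonneg.2 ht.1.le)]
  refine (h1.union h2).mono_set fun t ht => ?_
  rw [Ioc_union_Ioc_eq_Ioc zero_le_one one_le_two]
  exact ⟨by linarith [ht.1], ht.2⟩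

lemma integrableOn_abs_one_sub_rpow_div {α τ : ℝ} (hα : 0 < α) (hτ : τ ∈ Ioo (-1 : ℝ) 0) :
    IntegrableOn (fun t : ℝ => |1 - t| ^ τ / t ^ (1 + 2 * α)) (Ioi (1 / 2)) := by
  have hm : Measurable (fun t : ℝ => |1 - t| ^ τ / t ^ (1 + 2 * α)) := by fun_prop
  rw [← Ioc_union_Ioi_eq_Ioi (show (1 / 2 : ℝ) ≤ 2 by norm_num)]
  refine IntegrableOn.union ?_ ?_
  · refine Integrable.mono' ((integrableOn_abs_one_sub_rpow hτ.1).const_mul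
      (((1 / 2 : ℝ) ^ (1 + 2 * α))⁻¹)) hm.aestronglyMeasurable ?_
    refine (ae_restrict_iff' measurableSet_Ioc).2 (Filter.Eventually.of_forall fun t ht => ?_)
    have ht0 : (0 : ℝ) < t := by linarith [ht.1]
    rw [Real.norm_of_nonneg (by positivity), div_eq_inv_mul]
    gcongr
    exact ht.1.le
  · refine Integrable.mono' (integrableOn_Ioi_rpow_of_lt (show -(1 + 2 * α) < -1 by linarith)
      two_pos) hm.aestronglyMeasurable ?_
    refine (ae_restrict_iff' measurableSet_Ioi).2 (Filter.Eventually.of_forall fun t ht => ?_)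
    have ht2 : (2 : ℝ) < t := ht
    have ht0 : (0 : ℝ) < t := by linarith
    rw [Real.norm_of_nonneg (by positivity), Real.rpow_neg ht0.le, ← one_div]
    gcongr
    refine Real.rpow_le_one_of_one_le_of_nonpos ?_ hτ.2.le
    rw [abs_sub_comm, abs_of_nonneg] <;> linarith

lemma one_sub_rpow_add_one_add_rpow_sub_two_mem {τ t : ℝ} (hτ : τ ∈ Ioo (-1 : ℝ) 0)
    (ht : t ∈ Ioc (0 : ℝ) (1 / 2)) :
    |1 - t| ^ τ + (1 + t) ^ τ - 2 ∈ Icc 0 (3 * t ^ 2) := by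
  obtain ⟨h0, h1⟩ := ht
  have hp : 0 < 1 - t := by linarith
  have hq : 0 < 1 + t := by linarith
  rw [abs_of_pos hp]
  constructor
  · have hpq : 1 ≤ (1 - t) ^ τ * (1 + t) ^ τ := by
      rw [← Real.mul_rpow hp.le hq.le]
      exact Real.one_le_rpow_of_pos_of_le_one_of_nonpos (by positivity) (by nlinarith) hτ.2.le
    have hp' : 0 < (1 - t) ^ τ := by positivity
    have hq' : 0 < (1 + t) ^ τ := by positivity
    nlinarith [sq_nonneg ((1 - t) ^ τ - (1 + t) ^ τ)]
  · have ha := rpow_mul_le_affine (σ := -1) (θ := -τ) hp.le (by linarith [hτ.2])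
      (by linarith [hτ.1])
    have hb := rpow_mul_le_affine (σ := -1) (θ := -τ) hq.le (by linarith [hτ.2])
      (by linarith [hτ.1])
    simp only [neg_mul_neg, one_mul, Real.rpow_neg_one] at ha hb
    have hc : (1 - t)⁻¹ + (1 + t)⁻¹ - 2 = 2 * t ^ 2 / (1 - t ^ 2) := by
      have : 1 - t ^ 2 = (1 - t) * (1 + t) := by ring
      rw [this]
      field_simp
      ring
    have hd : 2 * t ^ 2 / (1 - t ^ 2) ≤ 3 * t ^ 2 := by
      rw [div_le_iff₀ (by nlinarith)]
      nlinarith [mul_nonneg (sq_nonneg t) (show 0 ≤ 1 / 4 - t ^ 2 by nlinarith)]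
    have he : -τ * ((1 - t)⁻¹ + (1 + t)⁻¹ - 2) ≤ 3 * t ^ 2 := by
      rw [hc]
      have : 0 ≤ 2 * t ^ 2 / (1 - t ^ 2) := div_nonneg (by positivity) (by nlinarith)
      nlinarith [hτ.1]
    linarith

lemma integrableOn_c_integrand {α τ : ℝ} (hα : α ∈ Ioo (0 : ℝ) 1) (hτ : τ ∈ Ioo (-1 : ℝ) 0) :
    IntegrableOn (fun t : ℝ => (|1 - t| ^ τ + (1 + t) ^ τ - 2) / t ^ (1 + 2 * α)) (Ioi 0) := by
  rw [← Ioc_union_Ioi_eq_Ioi (show (0 : ℝ) ≤ 1 / 2 by norm_num)]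
  refine IntegrableOn.union ?_ ?_
  · have h := (intervalIntegrable_iff_integrableOn_Ioc_of_le (show (0 : ℝ) ≤ 1 / 2 by norm_num)).1
      (intervalIntegral.intervalIntegrable_rpow' (show -1 < 1 - 2 * α by linarith [hα.2]))
    refine Integrable.mono' (h.const_mul 3) (Measurable.aestronglyMeasurable (by fun_prop)) ?_
    refine (ae_restrict_iff' measurableSet_Ioc).2 (Filter.Eventually.of_forall fun t ht => ?_)
    obtain ⟨hl, hu⟩ := one_sub_rpow_add_one_add_rpow_sub_two_mem hτ ht
    have ht0 : 0 < t := ht.1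
    rw [Real.norm_of_nonneg (by positivity), div_le_iff₀ (by positivity), mul_assoc,
      ← Real.rpow_add ht0]
    ring_nf at hu ⊢
    exact_mod_cast hu
  · have h : IntegrableOn (fun t : ℝ => ((1 + t) ^ τ - 2) / t ^ (1 + 2 * α)) (Ioi (1 / 2)) := by
      refine Integrable.mono' ((integrableOn_Ioi_rpow_of_lt
        (show -(1 + 2 * α) < -1 by linarith [hα.1]) one_half_pos).const_mul 2)
        (Measurable.aestronglyMeasurable (by fun_prop)) ?_
      refine (ae_restrict_iff' measurableSet_Ioi).2 (Filter.Eventually.of_forall fun t ht => ?_)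
      have ht0 : (0 : ℝ) < t := lt_trans one_half_pos ht
      have h1 : (1 + t) ^ τ ≤ 1 := Real.rpow_le_one_of_one_le_of_nonpos (by linarith) hτ.2.le
      have h0 : 0 < (1 + t) ^ τ := by positivity
      rw [norm_div, Real.norm_of_nonneg (Real.rpow_nonneg ht0.le _), Real.rpow_neg ht0.le,
        ← div_eq_mul_inv]
      gcongr
      rw [Real.norm_eq_abs, abs_le]
      constructor <;> linarith
    refine ((integrableOn_abs_one_sub_rpow_div hα.1 hτ).add h).congr_fun (fun t _ => ?_)
      measurableSet_Ioi
    simp only [Pi.add_apply]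
    ring

lemma integrableOn_bigC_integrand {α τ : ℝ} (hα : α ∈ Ioo (0 : ℝ) 1)
    (hτ : τ ∈ Ioo (-1 : ℝ) 0) :
    IntegrableOn (fun t : ℝ => ((Ioo (0 : ℝ) 1).indicator (fun s => |1 - s| ^ τ) t
      + (1 + t) ^ τ - 2) / t ^ (1 + 2 * α)) (Ioi 0) := by
  have h : IntegrableOn ((Ici (1 : ℝ)).indicator fun t : ℝ => |1 - t| ^ τ / t ^ (1 + 2 * α))
      (Ioi 0) := by
    refine Integrable.integrableOn ?_
    rw [integrable_indicator_iff measurableSet_Ici]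
    exact (integrableOn_abs_one_sub_rpow_div hα.1 hτ).mono_set
      (Ici_subset_Ioi.2 (by norm_num))
  refine ((integrableOn_c_integrand hα hτ).sub h).congr_fun (fun t ht => ?_) measurableSet_Ioi
  have ht0 : 0 < t := ht
  rcases lt_or_ge t 1 with h1 | h1
  · simp [indicator, ht0, h1]
  · simp [indicator, h1, not_lt.2 h1]
    ring

theorem tau0_lt_tau1 (α : ℝ) (hα : α ∈ Set.Ioo (0:ℝ) 1) (hT : 0 < T α)
    (τ₁ : ℝ) (hτ₁ : τ₁ ∈ Set.Ioo (-1:ℝ) 0) (hc : c α τ₁ = 0)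
    (τ₀ : ℝ) (hτ₀ : τ₀ ∈ Set.Ioo (-1:ℝ) 0) (hC : bigC α τ₀ = 0) :
    τ₀ < τ₁ := by
  by_contra! hle
  have hneg : τ₁ < 0 := hτ₁.2
  set θ := τ₀ / τ₁ with hθ
  have hθ0 : 0 ≤ θ := div_nonneg_of_nonpos hτ₀.2.le hneg.le
  have hθ1 : θ ≤ 1 := (div_le_one_of_neg hneg).2 hle
  have hmul : τ₁ * θ = τ₀ := mul_div_cancel₀ _ hneg.ne
  have hconv : ∀ x : ℝ, 0 ≤ x → x ^ τ₀ ≤ θ * x ^ τ₁ + (1 - θ) := fun x hx =>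
    hmul ▸ rpow_mul_le_affine (σ := τ₁) hx hθ0 hθ1
  have hi₁ := (integrableOn_c_integrand hα hτ₁).const_mul θ
  have hi₀ := integrableOn_bigC_integrand hα hτ₀
  have hgap : ∀ t ∈ Ioi (0 : ℝ),
      (Ici (1 : ℝ)).indicator (fun t : ℝ => |1 - t| ^ τ₀ / t ^ (1 + 2 * α)) t ≤
      θ * ((|1 - t| ^ τ₁ + (1 + t) ^ τ₁ - 2) / t ^ (1 + 2 * α)) -
      ((Ioo (0 : ℝ) 1).indicator (fun s => |1 - s| ^ τ₀) t + (1 + t) ^ τ₀ - 2)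
        / t ^ (1 + 2 * α) := by
    intro t ht
    have ht0 : 0 < t := ht
    have ha := hconv |1 - t| (abs_nonneg _)
    have hb := hconv (1 + t) (by linarith)
    rw [← mul_div_assoc, ← sub_div]
    rcases lt_or_ge t 1 with h1 | h1
    · simp only [indicator, mem_Ici, not_le.2 h1, mem_Ioo, ht0, h1, and_self, if_true, if_false]
      exact div_nonneg (by linarith) (by positivity)
    · simp only [indicator, mem_Ici, h1, mem_Ioo, not_lt.2 h1, and_false, if_true, if_false]
      gcongr
      linarith
  have hpos : 0 < ∫ t in Ioi (0 : ℝ),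
      (θ * ((|1 - t| ^ τ₁ + (1 + t) ^ τ₁ - 2) / t ^ (1 + 2 * α)) -
      ((Ioo (0 : ℝ) 1).indicator (fun s => |1 - s| ^ τ₀) t + (1 + t) ^ τ₀ - 2)
        / t ^ (1 + 2 * α)) := by
    refine (setIntegral_pos_iff_support_of_nonneg_ae ?_ (hi₁.sub hi₀)).2 ?_
    · refine (ae_restrict_iff' measurableSet_Ioi).2 (Filter.Eventually.of_forall fun t ht => ?_)
      refine le_trans (indicator_nonneg (fun s hs => ?_) t) (hgap t ht)
      have : (0 : ℝ) < s := lt_of_lt_of_le one_pos hs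
      positivity
    · refine lt_of_lt_of_le (?_ : 0 < volume (Ioi (1 : ℝ))) (measure_mono fun t ht => ?_)
      · simp
      · have ht1 : (1 : ℝ) < t := ht
        have ht0 : (0 : ℝ) < t := by linarith
        have hg := hgap t ht0
        rw [indicator_of_mem (mem_Ici.2 ht1.le)] at hg
        have : 0 < |1 - t| := abs_pos.2 (by linarith)
        exact ⟨(lt_of_lt_of_le (by positivity) hg).ne', ht0⟩
  rw [integral_sub hi₁ hi₀, integral_const_mul] at hpos
  change 0 < θ * c α τ₁ - bigC α τ₀ at hpos
  simp [hc, hC] at hpos
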